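/- arXiv:2504.19727 — 2 statements merged into one kernel-verified Lean document; each statement's English description precedes it below -/
import Mathlib

section
/- For every complex number q with |q| < 1, the series \sum_{n=0}^{\infty} o3(n) q^n converges absolutely and equals q^2 (q^2; q^4)_{\infty} / ((1 + q^3) (q; q)_{\infty}) + 1, i.e. q^2 \prod_{j=0}^{\infty} (1 - q^{4j+2}) / \left( (1 + q^3) \prod_{j=0}^{\infty} (1 - q^{j+1}) \right) + 1. -/
/-- `o3 n` is the number of partitions of `n` in which every odd part
appears at most once, the largest part is even, and the largest part
appears exactly once; `o3 0 = 1` (the empty partition is counted). -/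
noncomputable def o3 (n : ℕ) : ℕ :=
  Nat.card {p : n.Partition //
    (∀ a : ℕ, Odd a → p.parts.count a ≤ 1) ∧ Even p.parts.sup ∧
      (p.parts = 0 ∨ p.parts.count p.parts.sup = 1)}

open Finset Filter Topology PowerSeries
open scoped PowerSeries.WithPiTopology

/-- The power series `F` converges absolutely at `q`, with value `v`. -/
def HasAbsEval (F : ℂ⟦X⟧) (q v : ℂ) : Prop :=
  Summable (fun n ↦ ‖coeff n F * q ^ n‖) ∧ ∑' n, coeff n F * q ^ n = v

lemma HasAbsEval.hasSum {F : ℂ⟦X⟧} {q v : ℂ} (h : HasAbsEval F q v) :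
    HasSum (fun n ↦ coeff n F * q ^ n) v :=
  h.2 ▸ h.1.of_norm.hasSum

lemma HasAbsEval.one (q : ℂ) : HasAbsEval 1 q 1 := by
  have h : ∀ n, n ≠ 0 → coeff n (1 : ℂ⟦X⟧) * q ^ n = 0 := fun n hn ↦ by simp [coeff_one, hn]
  refine ⟨summable_of_ne_finset_zero (s := {0}) fun n hn ↦ ?_, ?_⟩
  · rw [h n (by simpa using hn), norm_zero]
  · rw [tsum_eq_single 0 h]
    simp

lemma HasAbsEval.mul {F G : ℂ⟦X⟧} {q v w : ℂ} (hF : HasAbsEval F q v) (hG : HasAbsEval G q w) :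
    HasAbsEval (F * G) q (v * w) := by
  have h : ∀ n, coeff n (F * G) * q ^ n =
      ∑ kl ∈ antidiagonal n, (coeff kl.1 F * q ^ kl.1) * (coeff kl.2 G * q ^ kl.2) := fun n ↦ by
    rw [coeff_mul, sum_mul]
    refine sum_congr rfl fun kl hkl ↦ ?_
    rw [← mem_antidiagonal.mp hkl, pow_add]
    ring
  unfold HasAbsEval
  rw [tsum_congr h, ← hF.2, ← hG.2]
  refine ⟨(summable_norm_sum_mul_antidiagonal_of_summable_norm
    (f := fun n ↦ coeff n F * q ^ n) (g := fun n ↦ coeff n G * q ^ n) hF.1 hG.1).congr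
    fun n ↦ by rw [h], ?_⟩
  exact (tsum_mul_tsum_eq_tsum_sum_antidiagonal_of_summable_norm
    (f := fun n ↦ coeff n F * q ^ n) (g := fun n ↦ coeff n G * q ^ n) hF.1 hG.1).symm

lemma HasAbsEval.prod {ι : Type*} {F : ι → ℂ⟦X⟧} {q : ℂ} {v : ι → ℂ} (s : Finset ι)
    (h : ∀ i ∈ s, HasAbsEval (F i) q (v i)) : HasAbsEval (∏ i ∈ s, F i) q (∏ i ∈ s, v i) := by
  classical
  induction s using Finset.induction_on with
  | empty => simpa using HasAbsEval.one q
  | insert a s ha ih =>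
    rw [prod_insert ha, prod_insert ha]
    exact (h a (mem_insert_self a s)).mul (ih fun i hi ↦ h i (mem_insert_of_mem hi))

/-- The factor of `Nat.Partition.genFun` belonging to the part `i + 1` can be evaluated termwise. -/
lemma hasAbsEval_genFun_factor (g : ℕ → ℂ) (i : ℕ) {q v : ℂ}
    (hs : Summable fun c ↦ ‖g (c + 1) * q ^ ((i + 1) * (c + 1))‖)
    (hv : 1 + ∑' c, g (c + 1) * q ^ ((i + 1) * (c + 1)) = v) :
    HasAbsEval (1 + ∑' c, g (c + 1) • (X : ℂ⟦X⟧) ^ ((i + 1) * (c + 1))) q v := by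
  set F : ℂ⟦X⟧ := 1 + ∑' c, g (c + 1) • (X : ℂ⟦X⟧) ^ ((i + 1) * (c + 1)) with hF
  have hcoeff : ∀ n, coeff n F = coeff n (1 : ℂ⟦X⟧) +
      ∑' c, g (c + 1) * if n = (i + 1) * (c + 1) then 1 else 0 := fun n ↦ by
    rw [hF, map_add, (Nat.Partition.summable_genFun_term (fun _ ↦ g) i).map_tsum _
      (WithPiTopology.continuous_coeff ℂ n)]
    simp [coeff_X_pow]
  have hinj : Function.Injective fun c ↦ (i + 1) * c := fun a b h ↦ by simpa using h
  have hval : ∀ c, coeff ((i + 1) * (c + 1)) F = g (c + 1) := fun c ↦ by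
    rw [hcoeff, tsum_eq_single c]
    · simp [coeff_one]
    · intro b hb
      simp [Ne.symm hb]
  have hval0 : coeff 0 F = 1 := by
    rw [hcoeff]
    simp
  have hzero : ∀ n, n ∉ Set.range (fun c ↦ (i + 1) * c) → coeff n F = 0 := fun n hn ↦ by
    have h1 : n ≠ 0 := fun h ↦ hn ⟨0, by simp [h]⟩
    have h2 : ∀ c, n ≠ (i + 1) * (c + 1) := fun c h ↦ hn ⟨c + 1, h.symm⟩
    rw [hcoeff]
    simp [coeff_one, h1, h2]
  have hs' : Summable fun c ↦ ‖coeff ((i + 1) * c) F * q ^ ((i + 1) * c)‖ := by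
    rw [← summable_nat_add_iff 1]
    simpa only [hval] using hs
  refine ⟨?_, ?_⟩
  · refine (hinj.summable_iff fun n hn ↦ ?_).mp hs'
    simp [hzero n hn]
  · rw [← hinj.tsum_eq, hs'.of_norm.tsum_eq_zero_add]
    · simpa [hval, hval0] using hv
    · intro n hn
      by_contra h
      exact hn (by simp [hzero n h])

/-- Partitions all of whose parts `i` satisfy `P i (count i)`, when `P` bounds the parts by `m`. -/
lemma hasSum_card_partitions_filter (P : ℕ → ℕ → Prop) [∀ i c, Decidable (P i c)] {m : ℕ}
    (hP : ∀ i c, P i c → i ≤ m) {q : ℂ} {v : ℕ → ℂ}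
    (hs : ∀ i < m, Summable fun c ↦
      ‖(if P (i + 1) (c + 1) then 1 else 0) * q ^ ((i + 1) * (c + 1))‖)
    (hv : ∀ i < m, 1 + ∑' c, (if P (i + 1) (c + 1) then 1 else 0) * q ^ ((i + 1) * (c + 1)) = v i) :
    HasSum (fun n ↦ (#{p : n.Partition | ∀ i ∈ p.parts, P i (p.parts.count i)} : ℂ) * q ^ n)
      (∏ i ∈ range m, v i) := by
  have hfac := HasAbsEval.prod (range m) fun i hi ↦
    hasAbsEval_genFun_factor (fun c ↦ if P (i + 1) c then 1 else 0) i
      (hs i (mem_range.mp hi)) (hv i (mem_range.mp hi))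
  have hgen := (Nat.Partition.hasProd_genFun fun i c ↦ if P i c then (1 : ℂ) else 0).unique
    (hasProd_prod_of_ne_finset_one (s := range m) fun i hi ↦ by
      have : ∀ c, ¬ P (i + 1) c := fun c h ↦ by
        have := hP _ _ h
        simp at hi
        omega
      simp [this])
  rw [← hgen] at hfac
  convert hfac.hasSum using 3 with n
  rw [Nat.Partition.coeff_genFun, card_filter, Nat.cast_sum]
  refine sum_congr rfl fun p _ ↦ ?_
  rw [Finsupp.prod, prod_boole]
  simp

/-- Generating function of the partitions with parts at most `m`, in which the parts satisfying `R`
are not repeated. -/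
lemma hasSum_card_partitions_le (R : ℕ → Prop) [DecidablePred R] (m : ℕ) {q : ℂ} (hq : ‖q‖ < 1) :
    HasSum (fun n ↦
      (#{p : n.Partition | ∀ i ∈ p.parts, i ≤ m ∧ (R i → p.parts.count i ≤ 1)} : ℂ) * q ^ n)
      (∏ i ∈ range m, if R (i + 1) then 1 + q ^ (i + 1) else (1 - q ^ (i + 1))⁻¹) := by
  refine hasSum_card_partitions_filter (fun i c ↦ i ≤ m ∧ (R i → c ≤ 1)) (fun i c h ↦ h.1)
    (fun i hi ↦ ?_) (fun i hi ↦ ?_)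
  all_goals
    have hi' : i + 1 ≤ m := hi
    have hqi : ‖q ^ (i + 1)‖ < 1 := by
      rw [norm_pow]
      exact pow_lt_one₀ (norm_nonneg q) hq (by simp)
    by_cases hR : R (i + 1)
  · refine summable_of_ne_finset_zero (s := {0}) fun c hc ↦ ?_
    simp at hc
    simp [hR, hc]
  · simp only [hi', hR, false_imp_iff, and_self, if_true, one_mul, pow_mul]
    exact (summable_nat_add_iff 1).mpr (summable_norm_geometric_of_norm_lt_one hqi)
  · rw [tsum_eq_single 0 fun c hc ↦ by simp [hR, hc]]
    simp [hi', hR]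
  · simp only [hi', hR, false_imp_iff, and_self, if_true, one_mul, pow_mul, if_false]
    rw [← tsum_geometric_of_norm_lt_one hqi,
      (summable_geometric_of_norm_lt_one hqi).tsum_eq_zero_add, pow_zero]

open Classical in
/-- The partitions counted by `o3 n` whose largest part is `2 * k` (or `2 * k + 1`, which cannot
happen). -/
noncomputable def o3Fiber (n k : ℕ) : Finset n.Partition :=
  {p | ((∀ a : ℕ, Odd a → p.parts.count a ≤ 1) ∧ Even p.parts.sup ∧
      (p.parts = 0 ∨ p.parts.count p.parts.sup = 1)) ∧ p.parts.sup / 2 = k}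

lemma Nat.Partition.sup_parts_le {n : ℕ} (p : n.Partition) : p.parts.sup ≤ n :=
  Multiset.sup_le.mpr fun _ ha ↦ (Multiset.le_sum_of_mem ha).trans_eq p.parts_sum

lemma o3Fiber_eq_empty {n k : ℕ} (h : n < k) : o3Fiber n k = ∅ := by
  classical
  rw [o3Fiber, filter_eq_empty_iff]
  intro p _ hp
  have := p.sup_parts_le
  omega

lemma hasSum_card_o3Fiber (n : ℕ) : HasSum (fun k ↦ (#(o3Fiber n k) : ℂ)) (o3 n) := by
  classical
  have h : o3 n = ∑ k ∈ range (n + 1), #(o3Fiber n k) := by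
    rw [o3, Nat.card_eq_fintype_card, Fintype.card_subtype,
      card_eq_sum_card_fiberwise (f := fun p ↦ p.parts.sup / 2) (t := range (n + 1))]
    · refine sum_congr rfl fun k _ ↦ ?_
      rw [o3Fiber, filter_filter]
    · intro p _
      have := p.sup_parts_le
      simp
      omega
  rw [h, Nat.cast_sum]
  refine hasSum_sum_of_ne_finset_zero fun k hk ↦ ?_
  have hk' : n < k := by
    rw [mem_range] at hk
    omega
  simp [o3Fiber_eq_empty hk']

lemma card_o3Fiber_zero (n : ℕ) : #(o3Fiber n 0) = if n = 0 then 1 else 0 := by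
  classical
  have hparts : ∀ p ∈ o3Fiber n 0, p.parts = 0 := fun p hp ↦ by
    simp only [o3Fiber, mem_filter] at hp
    obtain ⟨-, ⟨-, heven, -⟩, hdiv⟩ := hp
    have hsup : p.parts.sup = 0 := by
      obtain ⟨r, hr⟩ := heven
      omega
    refine Multiset.eq_zero_of_forall_notMem fun a ha ↦ ?_
    have h1 := p.parts_pos ha
    have h2 := Multiset.le_sup ha
    omega
  split_ifs with hn
  · subst hn
    rw [card_eq_one]
    refine ⟨default, eq_singleton_iff_unique_mem.mpr ⟨?_, fun p _ ↦ Subsingleton.elim _ _⟩⟩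
    simp [o3Fiber]
  · rw [card_eq_zero, eq_empty_iff_forall_notMem]
    intro p hp
    exact hn (by rw [← p.parts_sum, hparts p hp, Multiset.sum_zero])

lemma card_o3Fiber_succ (n k : ℕ) :
    #(o3Fiber n (k + 1)) + #{p : n.Partition |
      ∀ i ∈ p.parts, i ≤ 2 * k + 1 ∧ (Odd i → p.parts.count i ≤ 1)} =
    #{p : n.Partition | ∀ i ∈ p.parts, i ≤ 2 * k + 2 ∧
      (Odd i ∨ i = 2 * k + 2 → p.parts.count i ≤ 1)} := by
  classical
  rw [← card_union_of_disjoint]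
  · congr 1
    ext p
    simp only [o3Fiber, mem_union, mem_filter, mem_univ, true_and]
    constructor
    · rintro (⟨⟨hodd, heven, hcount⟩, hdiv⟩ | h)
      · intro i hi
        have h1 := Multiset.le_sup hi
        have hsup : p.parts.sup = 2 * k + 2 := by
          obtain ⟨r, hr⟩ := heven
          omega
        refine ⟨by omega, ?_⟩
        rintro (h | h)
        · exact hodd i h
        · rcases hcount with h0 | h0
          · simp [h0] at hi
          · rw [h, ← hsup, h0]
      · intro i hi
        obtain ⟨h1, h2⟩ := h i hi
        exact ⟨by omega, fun h ↦ h2 (h.resolve_right (by omega))⟩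
    · intro h
      by_cases hmem : 2 * k + 2 ∈ p.parts
      · left
        have hsup : p.parts.sup = 2 * k + 2 :=
          le_antisymm (Multiset.sup_le.mpr fun i hi ↦ (h i hi).1) (Multiset.le_sup hmem)
        rw [hsup]
        refine ⟨⟨fun a ha ↦ ?_, ⟨k + 1, by ring⟩, Or.inr ?_⟩, by omega⟩
        · by_cases hap : a ∈ p.parts
          · exact (h a hap).2 (Or.inl ha)
          · simp [hap]
        · exact le_antisymm ((h _ hmem).2 (Or.inr rfl)) (Multiset.one_le_count_iff_mem.mpr hmem)
      · right
        intro i hi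
        obtain ⟨h1, h2⟩ := h i hi
        have : i ≠ 2 * k + 2 := fun h ↦ hmem (h ▸ hi)
        exact ⟨by omega, fun h ↦ h2 (Or.inl h)⟩
  · rw [disjoint_left]
    intro p hp hp'
    simp only [o3Fiber, mem_filter, mem_univ, true_and] at hp hp'
    have : p.parts.sup ≤ 2 * k + 1 := Multiset.sup_le.mpr fun i hi ↦ (hp' i hi).1
    omega

/-- The generating function of partitions into distinct odd parts at most `2 * k + 1` and arbitrary
even parts at most `2 * k`. -/
noncomputable def oddDistinctProd (q : ℂ) (k : ℕ) : ℂ :=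
  ∏ i ∈ range (2 * k + 1), if Odd (i + 1) then 1 + q ^ (i + 1) else (1 - q ^ (i + 1))⁻¹

lemma oddDistinctProd_zero (q : ℂ) : oddDistinctProd q 0 = 1 + q := by
  simp [oddDistinctProd]

lemma oddDistinctProd_succ (q : ℂ) (k : ℕ) : oddDistinctProd q (k + 1) =
    oddDistinctProd q k * (1 - q ^ (2 * k + 2))⁻¹ * (1 + q ^ (2 * k + 3)) := by
  rw [oddDistinctProd, show 2 * (k + 1) + 1 = 2 * k + 1 + 1 + 1 by ring, prod_range_succ,
    prod_range_succ, if_neg (by grind), if_pos (by grind)]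
  rfl

lemma hasSum_card_o3Fiber_zero (q : ℂ) : HasSum (fun n ↦ (#(o3Fiber n 0) : ℂ) * q ^ n) 1 := by
  have h := hasSum_single (f := fun n ↦ (#(o3Fiber n 0) : ℂ) * q ^ n) 0
    fun n hn ↦ by simp [card_o3Fiber_zero, hn]
  simpa [card_o3Fiber_zero] using h

lemma hasSum_card_o3Fiber_succ {q : ℂ} (hq : ‖q‖ < 1) (k : ℕ) :
    HasSum (fun n ↦ (#(o3Fiber n (k + 1)) : ℂ) * q ^ n) (q ^ (2 * k + 2) * oddDistinctProd q k) := by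
  have hA := hasSum_card_partitions_le (fun i ↦ Odd i ∨ i = 2 * k + 2) (2 * k + 2) hq
  have hB := hasSum_card_partitions_le (fun i ↦ Odd i) (2 * k + 1) hq
  have hval : (∏ i ∈ range (2 * k + 2),
      if Odd (i + 1) ∨ i + 1 = 2 * k + 2 then 1 + q ^ (i + 1) else (1 - q ^ (i + 1))⁻¹) =
      oddDistinctProd q k * (1 + q ^ (2 * k + 2)) := by
    rw [prod_range_succ, if_pos (Or.inr rfl), oddDistinctProd]
    congr 1
    refine prod_congr rfl fun i hi ↦ if_congr (or_iff_left ?_) rfl rfl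
    rw [mem_range] at hi
    omega
  have h := hA.sub hB
  rw [hval, ← oddDistinctProd, mul_one_add, add_sub_cancel_left, mul_comm (oddDistinctProd q k)] at h
  refine h.congr_fun fun n ↦ ?_
  rw [← card_o3Fiber_succ]
  push_cast
  ring

section Limits

variable {q : ℂ}

lemma one_sub_pow_ne_zero_of_norm_lt_one (hq : ‖q‖ < 1) (n : ℕ) : 1 - q ^ (n + 1) ≠ 0 := by
  intro h
  have h1 : ‖q ^ (n + 1)‖ < 1 := by
    rw [norm_pow]
    exact pow_lt_one₀ (norm_nonneg q) hq (by simp)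
  rw [← sub_eq_zero.mp h, norm_one] at h1
  exact lt_irrefl _ h1

lemma one_add_pow_ne_zero_of_norm_lt_one (hq : ‖q‖ < 1) (n : ℕ) : 1 + q ^ (n + 1) ≠ 0 := by
  have h := one_sub_pow_ne_zero_of_norm_lt_one hq (2 * n + 1)
  rw [show 1 - q ^ (2 * n + 1 + 1) = (1 - q ^ (n + 1)) * (1 + q ^ (n + 1)) by ring] at h
  exact right_ne_zero_of_mul h

lemma sum_pow_mul_oddDistinctProd (hq : ‖q‖ < 1) (K : ℕ) :
    (1 + q ^ 3) * ∑ k ∈ range K, q ^ (2 * k + 2) * oddDistinctProd q k =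
      q ^ 2 * (1 - q ^ (2 * K)) * oddDistinctProd q K := by
  induction K with
  | zero => simp
  | succ K ih =>
    have h := one_sub_pow_ne_zero_of_norm_lt_one hq (2 * K + 1)
    rw [sum_range_succ, mul_add, ih, oddDistinctProd_succ, mul_add 2 K 1]
    field_simp
    ring

lemma oddDistinctProd_eq_div (hq : ‖q‖ < 1) (K : ℕ) :
    oddDistinctProd q K = (1 + q ^ (2 * K + 1)) * (∏ j ∈ range K, (1 - q ^ (4 * j + 2))) /
      ∏ j ∈ range (2 * K), (1 - q ^ (j + 1)) := by
  induction K with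
  | zero => simp [oddDistinctProd_zero]
  | succ K ih =>
    have h1 := one_sub_pow_ne_zero_of_norm_lt_one hq (2 * K)
    have h2 := one_sub_pow_ne_zero_of_norm_lt_one hq (2 * K + 1)
    have h3 : ∏ j ∈ range (2 * K), (1 - q ^ (j + 1)) ≠ 0 :=
      prod_ne_zero_iff.mpr fun j _ ↦ one_sub_pow_ne_zero_of_norm_lt_one hq j
    rw [oddDistinctProd_succ, ih, mul_add 2 K 1, mul_one, prod_range_succ, prod_range_succ _ (_ + 1),
      prod_range_succ _ (2 * K),
      show 1 - q ^ (4 * K + 2) = (1 - q ^ (2 * K + 1)) * (1 + q ^ (2 * K + 1)) by ring]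
    field_simp

lemma summable_norm_neg_pow_comp (hq : ‖q‖ < 1) {f : ℕ → ℕ} (hf : Function.Injective f) :
    Summable fun j ↦ ‖-q ^ f j‖ := by
  simp only [norm_neg, norm_pow]
  exact (summable_geometric_of_lt_one (norm_nonneg q) hq).comp_injective hf

lemma tendsto_prod_one_sub_pow (hq : ‖q‖ < 1) {f : ℕ → ℕ} (hf : Function.Injective f) :
    Tendsto (fun K ↦ ∏ j ∈ range K, (1 - q ^ f j)) atTop (𝓝 (∏' j, (1 - q ^ f j))) := by
  simp only [sub_eq_add_neg]
  exact (multipliable_one_add_of_summable (summable_norm_neg_pow_comp hq hf)).hasProd.tendsto_prod_nat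

lemma tprod_one_sub_pow_ne_zero (hq : ‖q‖ < 1) : ∏' j : ℕ, (1 - q ^ (j + 1)) ≠ 0 := by
  simp only [sub_eq_add_neg]
  refine tprod_one_add_ne_zero_of_summable (fun j ↦ ?_)
    (summable_norm_neg_pow_comp hq (add_left_injective 1))
  simpa only [sub_eq_add_neg] using one_sub_pow_ne_zero_of_norm_lt_one hq j

lemma tendsto_sum_pow_mul_oddDistinctProd (hq : ‖q‖ < 1) :
    Tendsto (fun K ↦ ∑ k ∈ range K, q ^ (2 * k + 2) * oddDistinctProd q k) atTop
      (𝓝 (q ^ 2 * (∏' j : ℕ, (1 - q ^ (4 * j + 2))) /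
          ((1 + q ^ 3) * ∏' j : ℕ, (1 - q ^ (j + 1))))) := by
  have hpow : Tendsto (fun K : ℕ ↦ q ^ (2 * K)) atTop (𝓝 0) :=
    (tendsto_pow_atTop_nhds_zero_of_norm_lt_one hq).comp
      (tendsto_id.const_mul_atTop' two_pos)
  have hden := (tendsto_prod_one_sub_pow hq (add_left_injective 1)).comp
    (tendsto_id.const_mul_atTop' two_pos : Tendsto (fun K : ℕ ↦ 2 * K) atTop atTop)
  have hnum := tendsto_prod_one_sub_pow hq (f := fun j ↦ 4 * j + 2) fun a b h ↦ by
    simpa using h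
  have h3 := one_add_pow_ne_zero_of_norm_lt_one hq 2
  have hlim := ((((tendsto_const_nhds (x := (1 : ℂ))).sub hpow).const_mul (q ^ 2)).mul
    ((((tendsto_const_nhds (x := (1 : ℂ))).add (hpow.mul_const q)).mul hnum).div hden
      (tprod_one_sub_pow_ne_zero hq))).div_const (1 + q ^ 3)
  convert hlim using 1
  · ext K
    rw [eq_div_iff h3, mul_comm, sum_pow_mul_oddDistinctProd hq, oddDistinctProd_eq_div hq, pow_succ]
    rfl
  · congr 1
    have := tprod_one_sub_pow_ne_zero hq
    field_simp
    ring

end Limits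

lemma tendsto_sum_tsum_o3Fiber {q : ℂ} (hq : ‖q‖ < 1) :
    Tendsto (fun K ↦ ∑ k ∈ range K, ∑' n, (#(o3Fiber n k) : ℂ) * q ^ n) atTop
      (𝓝 (q ^ 2 * (∏' j : ℕ, (1 - q ^ (4 * j + 2))) /
          ((1 + q ^ 3) * ∏' j : ℕ, (1 - q ^ (j + 1))) + 1)) := by
  rw [← tendsto_add_atTop_iff_nat 1]
  simp only [sum_range_succ', (hasSum_card_o3Fiber_zero q).tsum_eq,
    (hasSum_card_o3Fiber_succ hq _).tsum_eq]
  exact (tendsto_sum_pow_mul_oddDistinctProd hq).add_const 1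

lemma summable_card_o3Fiber {q : ℂ} (hq : ‖q‖ < 1) (k : ℕ) :
    Summable fun n ↦ (#(o3Fiber n k) : ℂ) * q ^ n := by
  cases k with
  | zero => exact (hasSum_card_o3Fiber_zero q).summable
  | succ k => exact (hasSum_card_o3Fiber_succ hq k).summable

lemma summable_norm_o3Fiber_prod {q : ℂ} (hq : ‖q‖ < 1) :
    Summable fun x : ℕ × ℕ ↦ ‖(#(o3Fiber x.2 x.1) : ℂ) * q ^ x.2‖ := by
  have hr : ‖((‖q‖ : ℝ) : ℂ)‖ < 1 := by simpa using hq
  have hterm : ∀ n k, (((‖(#(o3Fiber n k) : ℂ) * q ^ n‖ : ℝ)) : ℂ) =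
      (#(o3Fiber n k) : ℂ) * ((‖q‖ : ℝ) : ℂ) ^ n := fun n k ↦ by
    simp
  rw [summable_prod_of_nonneg fun _ ↦ norm_nonneg _]
  constructor
  · intro k
    exact (summable_card_o3Fiber hq k).norm
  · have h := Complex.continuous_re.continuousAt.tendsto.comp (tendsto_sum_tsum_o3Fiber hr)
    refine ((hasSum_iff_tendsto_nat_of_nonneg
      (fun k ↦ tsum_nonneg fun n ↦ norm_nonneg _) _).mpr (h.congr fun K ↦ ?_)).summable
    simp only [Function.comp_apply, ← hterm, ← Complex.ofReal_tsum, ← Complex.ofReal_sum,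
      Complex.ofReal_re]

theorem o3_generating_function_closed (q : ℂ) (hq : ‖q‖ < 1) :
    Summable (fun n : ℕ => ‖(o3 n : ℂ) * q ^ n‖) ∧
    ∑' n : ℕ, (o3 n : ℂ) * q ^ n =
      q ^ 2 * (∏' j : ℕ, (1 - q ^ (4 * j + 2))) /
          ((1 + q ^ 3) * ∏' j : ℕ, (1 - q ^ (j + 1))) + 1 := by
  have hsum := summable_norm_o3Fiber_prod hq
  have ho3 : ∀ n, HasSum (fun k ↦ (#(o3Fiber n k) : ℂ) * q ^ n) ((o3 n : ℂ) * q ^ n) :=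
    fun n ↦ (hasSum_card_o3Fiber n).mul_right _
  have hfiber := hsum.of_norm.hasSum.prod_fiberwise fun k ↦ (summable_card_o3Fiber hq k).hasSum
  have hswap := hsum.of_norm.prod_symm.hasSum.prod_fiberwise ho3
  refine ⟨hswap.summable.norm, ?_⟩
  rw [hswap.tsum_eq, ← tendsto_nhds_unique hfiber.tendsto_sum_nat (tendsto_sum_tsum_o3Fiber hq)]
  exact (Equiv.prodComm ℕ ℕ).tsum_eq fun x : ℕ × ℕ ↦ (#(o3Fiber x.2 x.1) : ℂ) * q ^ x.2
end

section
/- For every complex number q with |q| < 1, the series \sum_{n=0}^{\infty} c(n) q^n converges absolutely and equals (-q; q^2)_{\infty} / (q^2; q^2)_{\infty}, i.e. \prod_{j=0}^{\infty} (1 + q^{2j+1}) / \prod_{j=0}^{\infty} (1 - q^{2j+2}). -/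
/-- `c n` is the number of partitions of `n` in which no part is
congruent to 2 modulo 4; `c 0 = 1`. -/
noncomputable def c (n : ℕ) : ℕ :=
  Nat.card {p : n.Partition // ∀ a ∈ p.parts, a % 4 ≠ 2}

open PowerSeries Filter Topology
open scoped PowerSeries.WithPiTopology

section Evaluation

variable {𝕜 : Type*} [NormedField 𝕜]

/-- `P` converges absolutely at `x`, with value `a`. -/
def EvaluatesTo (P : ℕ⟦X⟧) (x a : 𝕜) : Prop :=
  Summable (fun n : ℕ => ‖((coeff n P : ℕ) : 𝕜) * x ^ n‖) ∧
    HasSum (fun n : ℕ => ((coeff n P : ℕ) : 𝕜) * x ^ n) a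

theorem EvaluatesTo.one (x : 𝕜) : EvaluatesTo 1 x 1 := by
  have h : ∀ n : ℕ, n ≠ 0 → ((coeff n (1 : ℕ⟦X⟧) : ℕ) : 𝕜) * x ^ n = 0 := by
    intro n hn
    simp [coeff_one, hn]
  refine ⟨summable_of_ne_finset_zero (s := {0}) fun n hn => ?_, ?_⟩
  · rw [h n (by simpa using hn), norm_zero]
  · simpa using hasSum_single 0 h

theorem EvaluatesTo.mul [CompleteSpace 𝕜] {P Q : ℕ⟦X⟧} {x a b : 𝕜}
    (hP : EvaluatesTo P x a) (hQ : EvaluatesTo Q x b) : EvaluatesTo (P * Q) x (a * b) := by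
  have key : ∀ n : ℕ, ((coeff n (P * Q) : ℕ) : 𝕜) * x ^ n =
      ∑ kl ∈ Finset.HasAntidiagonal.antidiagonal n,
        (((coeff kl.1 P : ℕ) : 𝕜) * x ^ kl.1) * (((coeff kl.2 Q : ℕ) : 𝕜) * x ^ kl.2) := by
    intro n
    rw [coeff_mul]
    push_cast
    rw [Finset.sum_mul]
    refine Finset.sum_congr rfl fun kl hkl => ?_
    rw [← Finset.HasAntidiagonal.mem_antidiagonal.mp hkl, pow_add]
    ring
  have hsum := summable_norm_sum_mul_antidiagonal_of_summable_norm hP.1 hQ.1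
  have htsum := tsum_mul_tsum_eq_tsum_sum_antidiagonal_of_summable_norm hP.1 hQ.1
  rw [hP.2.tsum_eq, hQ.2.tsum_eq] at htsum
  unfold EvaluatesTo
  simp_rw [key]
  exact ⟨hsum, htsum ▸ hsum.of_norm.hasSum⟩

end Evaluation

theorem coeff_tsum_X_pow_mul (i n : ℕ) :
    coeff n (∑' j : ℕ, (X : ℕ⟦X⟧) ^ ((i + 1) * j)) = if (i + 1) ∣ n then 1 else 0 := by
  have hs : Summable fun j : ℕ => (X : ℕ⟦X⟧) ^ ((i + 1) * j) := by
    simp_rw [pow_mul]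
    exact WithPiTopology.summable_pow_of_constantCoeff_eq_zero (by simp)
  rw [hs.map_tsum (coeff n) (WithPiTopology.continuous_coeff _ _)]
  simp_rw [coeff_X_pow]
  split_ifs with h
  · obtain ⟨k, rfl⟩ := h
    rw [tsum_eq_single k]
    · simp
    · intro j hj
      simp [hj.symm]
  · refine (tsum_congr fun j => if_neg ?_).trans tsum_zero
    rintro rfl
    exact h (dvd_mul_right _ _)

theorem evaluatesTo_tsum_X_pow_mul {𝕜 : Type*} [NormedField 𝕜] [CompleteSpace 𝕜]
    (i : ℕ) {x : 𝕜} (hx : ‖x‖ < 1) :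
    EvaluatesTo (∑' j : ℕ, X ^ ((i + 1) * j)) x (1 - x ^ (i + 1))⁻¹ := by
  unfold EvaluatesTo
  simp_rw [coeff_tsum_X_pow_mul]
  constructor
  · refine (summable_geometric_of_lt_one (norm_nonneg x) hx).of_nonneg_of_le
      (fun _ => norm_nonneg _) fun n => ?_
    split_ifs <;> simp
  · have hinj : Function.Injective fun j : ℕ => (i + 1) * j :=
      fun a b h => Nat.eq_of_mul_eq_mul_left i.succ_pos h
    rw [← hinj.hasSum_iff]
    · have hp : ‖x ^ (i + 1)‖ < 1 := by
        rw [norm_pow]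
        exact pow_lt_one₀ (norm_nonneg _) hx i.succ_ne_zero
      convert hasSum_geometric_of_norm_lt_one hp using 2 with j
      simp [pow_mul]
    · intro n hn
      rw [if_neg]
      · simp
      · rintro ⟨k, rfl⟩
        exact hn ⟨k, rfl⟩

section RestrictedParts

variable (p : ℕ → Prop) [DecidablePred p]

/-- The generating function of the partitions whose parts satisfy `p` and are at most `N`. -/
noncomputable def boundedGenFun (N : ℕ) : ℕ⟦X⟧ :=
  ∏ i ∈ Finset.range N, if p (i + 1) then ∑' j : ℕ, X ^ ((i + 1) * j) else 1

/-- The term `x ^ (i + 1)` if `i + 1` is an admissible part, and `0` otherwise. -/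
def partTerm {𝕜 : Type*} [NormedField 𝕜] (x : 𝕜) (i : ℕ) : 𝕜 :=
  if p (i + 1) then x ^ (i + 1) else 0

theorem coeff_boundedGenFun_mono (n : ℕ) : Monotone fun N => coeff n (boundedGenFun p N) := by
  refine monotone_nat_of_le_succ fun N => ?_
  rw [boundedGenFun, boundedGenFun, Finset.prod_range_succ]
  split_ifs
  · rw [coeff_mul]
    refine le_trans (le_of_eq ?_) (Finset.single_le_sum (fun _ _ => Nat.zero_le _)
      (show (n, 0) ∈ Finset.HasAntidiagonal.antidiagonal n by simp))
    rw [coeff_tsum_X_pow_mul]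
    simp
  · simp

theorem tendsto_coeff_boundedGenFun (n : ℕ) :
    Tendsto (fun N => coeff n (boundedGenFun p N)) atTop
      (𝓝 (Nat.Partition.restricted n p).card) := by
  have h := (Nat.Partition.hasProd_powerSeriesMk_card_restricted ℕ p).tendsto_prod_nat
  simpa [boundedGenFun] using ((WithPiTopology.continuous_coeff ℕ n).tendsto _).comp h

theorem coeff_boundedGenFun_le (n N : ℕ) :
    coeff n (boundedGenFun p N) ≤ (Nat.Partition.restricted n p).card :=
  (coeff_boundedGenFun_mono p n).ge_of_tendsto (tendsto_coeff_boundedGenFun p n) N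

variable {𝕜 : Type*} [NormedField 𝕜]

theorem evaluatesTo_boundedGenFun [CompleteSpace 𝕜] {x : 𝕜} (hx : ‖x‖ < 1) (N : ℕ) :
    EvaluatesTo (boundedGenFun p N) x (∏ i ∈ Finset.range N, (1 - partTerm p x i))⁻¹ := by
  induction N with
  | zero => simpa [boundedGenFun] using EvaluatesTo.one x
  | succ N ih =>
    rw [boundedGenFun, Finset.prod_range_succ, Finset.prod_range_succ, mul_inv]
    refine ih.mul ?_
    unfold partTerm
    split_ifs
    · exact evaluatesTo_tsum_X_pow_mul N hx
    · simpa using EvaluatesTo.one x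

theorem summable_norm_partTerm {x : 𝕜} (hx : ‖x‖ < 1) :
    Summable fun i => ‖-partTerm p x i‖ := by
  refine ((summable_nat_add_iff 1).mpr
    (summable_geometric_of_lt_one (norm_nonneg x) hx)).of_nonneg_of_le
      (fun _ => norm_nonneg _) fun i => ?_
  unfold partTerm
  split_ifs <;> simp

theorem one_sub_partTerm_ne_zero {x : 𝕜} (hx : ‖x‖ < 1) (i : ℕ) : 1 + -partTerm p x i ≠ 0 := by
  unfold partTerm
  split_ifs
  · intro h
    have h1 : x ^ (i + 1) = 1 := by linear_combination -h
    have h2 : ‖x ^ (i + 1)‖ < 1 := by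
      rw [norm_pow]
      exact pow_lt_one₀ (norm_nonneg _) hx i.succ_ne_zero
    simp [h1] at h2
  · simp

theorem tprod_one_sub_partTerm_ne_zero {q : ℂ} (hq : ‖q‖ < 1) :
    ∏' i, (1 - partTerm p q i) ≠ 0 := by
  simpa only [sub_eq_add_neg] using tprod_one_add_ne_zero_of_summable
    (one_sub_partTerm_ne_zero p hq) (summable_norm_partTerm p hq)

theorem tendsto_prod_one_sub_partTerm {q : ℂ} (hq : ‖q‖ < 1) :
    Tendsto (fun N => ∏ i ∈ Finset.range N, (1 - partTerm p q i)) atTop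
      (𝓝 (∏' i, (1 - partTerm p q i))) := by
  simp_rw [sub_eq_add_neg]
  have h : Multipliable fun i => 1 + -partTerm p q i :=
    multipliable_one_add_of_summable (summable_norm_partTerm p hq)
  exact h.tendsto_prod_tprod_nat

theorem summable_card_restricted {q : ℂ} (hq : ‖q‖ < 1) :
    Summable fun n => ((Nat.Partition.restricted n p).card : ℝ) * ‖q‖ ^ n := by
  have hr : ‖(‖q‖ : ℂ)‖ < 1 := by simpa using hq
  have hbdd := ((tendsto_prod_one_sub_partTerm p hr).inv₀
    (tprod_one_sub_partTerm_ne_zero p hr)).norm.bddAbove_range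
  obtain ⟨B, hB⟩ := hbdd
  refine summable_of_sum_le (c := B) (fun n => by positivity) fun s => ?_
  have hlim : Tendsto (fun N => ∑ n ∈ s, ((coeff n (boundedGenFun p N) : ℕ) : ℝ) * ‖q‖ ^ n) atTop
      (𝓝 (∑ n ∈ s, ((Nat.Partition.restricted n p).card : ℝ) * ‖q‖ ^ n)) :=
    tendsto_finsetSum _ fun n _ =>
      ((continuous_of_discreteTopology.tendsto _).comp
        (tendsto_coeff_boundedGenFun p n)).mul_const _
  refine le_of_tendsto' hlim fun N => ?_
  have hE := evaluatesTo_boundedGenFun p hr N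
  have hsum : HasSum (fun n => ((((coeff n (boundedGenFun p N) : ℕ) : ℝ) * ‖q‖ ^ n : ℝ) : ℂ))
      (∏ i ∈ Finset.range N, (1 - partTerm p (‖q‖ : ℂ) i))⁻¹ := by
    simpa using hE.2
  have hre := Complex.hasSum_re hsum
  simp only [Complex.ofReal_re] at hre
  exact (sum_le_hasSum s (fun n _ => by positivity) hre).trans
    ((Complex.re_le_norm _).trans (hB ⟨N, rfl⟩))

theorem tsum_card_restricted {q : ℂ} (hq : ‖q‖ < 1) :
    ∑' n, ((Nat.Partition.restricted n p).card : ℂ) * q ^ n =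
      (∏' i, (1 - partTerm p q i))⁻¹ := by
  have h1 : Tendsto (fun N => ∑' n, ((coeff n (boundedGenFun p N) : ℕ) : ℂ) * q ^ n) atTop
      (𝓝 (∑' n, ((Nat.Partition.restricted n p).card : ℂ) * q ^ n)) := by
    refine tendsto_tsum_of_dominated_convergence (summable_card_restricted p hq)
      (fun n => ((continuous_of_discreteTopology.tendsto _).comp
        (tendsto_coeff_boundedGenFun p n)).mul_const _) (Eventually.of_forall fun N n => ?_)
    rw [norm_mul, norm_pow, Complex.norm_natCast]
    have := coeff_boundedGenFun_le p n N
    gcongr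
  refine tendsto_nhds_unique h1 ?_
  simp_rw [(evaluatesTo_boundedGenFun p hq _).2.tsum_eq]
  exact (tendsto_prod_one_sub_partTerm p hq).inv₀ (tprod_one_sub_partTerm_ne_zero p hq)

end RestrictedParts

theorem c_eq_card_restricted (n : ℕ) :
    c n = (Nat.Partition.restricted n fun a => a % 4 ≠ 2).card := by
  rw [c, Nat.card_eq_fintype_card, Fintype.card_subtype, Nat.Partition.restricted]

theorem prod_one_sub_partTerm_mul (q : ℂ) (M : ℕ) :
    (∏ i ∈ Finset.range (4 * M), (1 - partTerm (fun a => a % 4 ≠ 2) q i)) *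
        ∏ j ∈ Finset.range (2 * M), (1 + q ^ (2 * j + 1)) =
      (∏ j ∈ Finset.range M, (1 - q ^ (4 * j + 4))) *
        ∏ j ∈ Finset.range (2 * M), (1 - q ^ (4 * j + 2)) := by
  induction M with
  | zero => simp
  | succ M ih =>
    have e1 : (4 * M + 1) % 4 ≠ 2 := by omega
    have e2 : ¬ (4 * M + 1 + 1) % 4 ≠ 2 := by omega
    have e3 : (4 * M + 2 + 1) % 4 ≠ 2 := by omega
    have e4 : (4 * M + 3 + 1) % 4 ≠ 2 := by omega
    have p1 : partTerm (fun a => a % 4 ≠ 2) q (4 * M) = q ^ (4 * M + 1) := if_pos e1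
    have p2 : partTerm (fun a => a % 4 ≠ 2) q (4 * M + 1) = 0 := if_neg e2
    have p3 : partTerm (fun a => a % 4 ≠ 2) q (4 * M + 2) = q ^ (4 * M + 3) := if_pos e3
    have p4 : partTerm (fun a => a % 4 ≠ 2) q (4 * M + 3) = q ^ (4 * M + 4) := if_pos e4
    rw [show 4 * (M + 1) = 4 * M + 1 + 1 + 1 + 1 by ring, show 2 * (M + 1) = 2 * M + 1 + 1 by ring]
    simp only [Finset.prod_range_succ, add_assoc, Nat.reduceAdd, p1, p2, p3, p4]
    linear_combination (1 - q ^ (4 * M + 1)) * (1 - q ^ (4 * M + 3)) * (1 - q ^ (4 * M + 4)) *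
      (1 + q ^ (4 * M + 1)) * (1 + q ^ (4 * M + 3)) * ih

theorem prod_one_sub_even_pow (q : ℂ) (M : ℕ) :
    ∏ j ∈ Finset.range (2 * M), (1 - q ^ (2 * j + 2)) =
      (∏ j ∈ Finset.range M, (1 - q ^ (4 * j + 4))) *
        ∏ j ∈ Finset.range M, (1 - q ^ (4 * j + 2)) := by
  induction M with
  | zero => simp
  | succ M ih =>
    rw [show 2 * (M + 1) = 2 * M + 1 + 1 by ring]
    simp only [Finset.prod_range_succ, ih]
    ring

theorem summable_norm_pow_mul_add {q : ℂ} (hq : ‖q‖ < 1) {a : ℕ} (ha : a ≠ 0) (b : ℕ) :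
    Summable fun j : ℕ => ‖q ^ (a * j + b)‖ := by
  have h : ‖q‖ ^ a < 1 := pow_lt_one₀ (norm_nonneg _) hq ha
  simpa [pow_add, pow_mul] using
    (summable_geometric_of_lt_one (by positivity) h).mul_right (‖q‖ ^ b)

theorem multipliable_one_sub_pow_mul_add {q : ℂ} (hq : ‖q‖ < 1) {a : ℕ} (ha : a ≠ 0) (b : ℕ) :
    Multipliable fun j : ℕ => 1 - q ^ (a * j + b) := by
  simp_rw [sub_eq_add_neg]
  refine multipliable_one_add_of_summable ?_
  simpa only [norm_neg] using summable_norm_pow_mul_add hq ha b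

theorem tprod_one_sub_even_pow_ne_zero {q : ℂ} (hq : ‖q‖ < 1) :
    ∏' j : ℕ, (1 - q ^ (2 * j + 2)) ≠ 0 := by
  simp_rw [sub_eq_add_neg]
  refine tprod_one_add_ne_zero_of_summable (fun j h => ?_) ?_
  · have h1 : q ^ (2 * j + 2) = 1 := by linear_combination -h
    have h2 : ‖q ^ (2 * j + 2)‖ < 1 := by
      rw [norm_pow]
      exact pow_lt_one₀ (norm_nonneg _) hq (by omega)
    simp [h1] at h2
  · simpa only [norm_neg] using summable_norm_pow_mul_add hq two_ne_zero 2

theorem tprod_one_sub_partTerm_mul {q : ℂ} (hq : ‖q‖ < 1) :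
    (∏' i, (1 - partTerm (fun a => a % 4 ≠ 2) q i)) * ∏' j : ℕ, (1 + q ^ (2 * j + 1)) =
      ∏' j : ℕ, (1 - q ^ (2 * j + 2)) := by
  have t2 : Tendsto (fun M : ℕ => 2 * M) atTop atTop :=
    tendsto_id.const_mul_atTop' two_pos
  have t4 : Tendsto (fun M : ℕ => 4 * M) atTop atTop :=
    tendsto_id.const_mul_atTop' four_pos
  have hD := (tendsto_prod_one_sub_partTerm (fun a => a % 4 ≠ 2) hq).comp t4
  have hA := (multipliable_one_add_of_summable
    (summable_norm_pow_mul_add hq two_ne_zero 1)).tendsto_prod_tprod_nat.comp t2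
  have hE := (multipliable_one_sub_pow_mul_add hq two_ne_zero 2).tendsto_prod_tprod_nat.comp t2
  have h0 := (multipliable_one_sub_pow_mul_add hq four_ne_zero 4).tendsto_prod_tprod_nat
  have h2 := (multipliable_one_sub_pow_mul_add hq four_ne_zero 2).tendsto_prod_tprod_nat
  have hl := tendsto_nhds_unique ((hD.mul hA).congr (prod_one_sub_partTerm_mul q))
    (h0.mul (h2.comp t2))
  have hr := tendsto_nhds_unique (hE.congr (prod_one_sub_even_pow q)) (h0.mul h2)
  rw [hl, hr]

theorem c_generating_function (q : ℂ) (hq : ‖q‖ < 1) :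
    Summable (fun n : ℕ => ‖(c n : ℂ) * q ^ n‖) ∧
    ∑' n : ℕ, (c n : ℂ) * q ^ n =
      (∏' j : ℕ, (1 + q ^ (2 * j + 1))) / ∏' j : ℕ, (1 - q ^ (2 * j + 2)) := by
  simp_rw [c_eq_card_restricted]
  constructor
  · simpa using summable_card_restricted (fun a => a % 4 ≠ 2) hq
  · rw [tsum_card_restricted _ hq, eq_div_iff (tprod_one_sub_even_pow_ne_zero hq),
      ← tprod_one_sub_partTerm_mul hq,
      inv_mul_cancel_left₀ (tprod_one_sub_partTerm_ne_zero _ hq)]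
end
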